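/- arXiv:1211.5568 — 6 statements merged into one kernel-verified Lean document; each statement's English description precedes it below -/
import Mathlib

section
/- Let C be a binary linear code of length n. If w is a coset leader of C and w = y + e_i for some y in F_2^n and some coordinate i in supp(w) (so that i is not in supp(y)), then y is also a coset leader of C. -/
/-- `w` is a coset leader of the binary code `C`: it has minimal Hamming weight
in its coset `w + C`. -/
def IsCosetLeader {n : ℕ} (C : Submodule (ZMod 2) (Fin n → ZMod 2))
    (w : Fin n → ZMod 2) : Prop :=
  ∀ v : Fin n → ZMod 2, w - v ∈ C → hammingNorm w ≤ hammingNorm v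

theorem hammingNorm_add_single_le {n : ℕ} (v : Fin n → ZMod 2) (i : Fin n) (a : ZMod 2) :
    hammingNorm (v + Pi.single i a) ≤ hammingNorm v + 1 := by
  classical
  unfold hammingNorm
  refine (Finset.card_le_card (t := insert i (Finset.univ.filter (v · ≠ 0))) fun j hj => ?_).trans
    (Finset.card_insert_le _ _)
  by_cases h : j = i <;> simp_all

theorem hammingNorm_add_single_of_eq_zero {n : ℕ} {y : Fin n → ZMod 2} {i : Fin n}
    (hy : y i = 0) {a : ZMod 2} (ha : a ≠ 0) :
    hammingNorm (y + Pi.single i a) = hammingNorm y + 1 := by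
  classical
  unfold hammingNorm
  rw [← Finset.card_insert_of_notMem (a := i) (by simp [hy])]
  congr 1
  ext j
  by_cases h : j = i <;> simp_all

theorem stmt_0 {n : ℕ} (C : Submodule (ZMod 2) (Fin n → ZMod 2))
    (w y : Fin n → ZMod 2) (i : Fin n)
    (hw : IsCosetLeader C w)
    (heq : w = y + Pi.single i 1)
    (hi : w i ≠ 0) :
    IsCosetLeader C y := by
  subst heq
  have hy : y i = 0 := by
    simp only [Pi.add_apply, Pi.single_eq_same] at hi
    generalize y i = a at hi
    revert a
    decide
  intro v hv
  have hle := hw (v + Pi.single i 1) (by rwa [add_sub_add_right_eq_sub])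
  rw [hammingNorm_add_single_of_eq_zero hy one_ne_zero] at hle
  exact Nat.le_of_add_le_add_right (hle.trans (hammingNorm_add_single_le v i 1))
end

section
/- Let C be a binary linear code of length n. The set of leader codewords L(C) is a test-set for C: for every y in F_2^n that is not a coset leader of C, there exists t in L(C) such that w_H(y + t) < w_H(y). -/
/-- The set of leader codewords of `C`:
`L(C) = {n1 + n2 + e_i ∈ C \ {0} : i ∉ supp n1, n1, n2 ∈ CL(C)}`. -/
def leaderCodewords {n : ℕ} (C : Submodule (ZMod 2) (Fin n → ZMod 2)) :
    Set (Fin n → ZMod 2) :=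
  {c | c ∈ C ∧ c ≠ 0 ∧ ∃ (n1 n2 : Fin n → ZMod 2) (i : Fin n),
    IsCosetLeader C n1 ∧ IsCosetLeader C n2 ∧ n1 i = 0 ∧
    c = n1 + n2 + Pi.single i 1}

theorem hammingNorm_pi_single_one_le {n : ℕ} (i : Fin n) :
    hammingNorm (Pi.single i 1 : Fin n → ZMod 2) ≤ 1 := by
  unfold hammingNorm
  refine (Finset.card_le_card (t := {i}) fun j hj => ?_).trans (Finset.card_singleton i).le
  by_contra h
  simp_all [Pi.single_apply]

theorem hammingNorm_add_le_add {n : ℕ} (x y : Fin n → ZMod 2) :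
    hammingNorm (x + y) ≤ hammingNorm x + hammingNorm y := by
  unfold hammingNorm
  refine (Finset.card_le_card fun j hj => ?_).trans (Finset.card_union_le _ _)
  simp only [Finset.mem_filter, Finset.mem_univ, true_and, Finset.mem_union, Pi.add_apply] at hj ⊢
  by_contra! h
  exact hj (by rw [h.1, h.2, add_zero])

theorem ZMod.eq_one_of_ne_zero_two {a : ZMod 2} (ha : a ≠ 0) : a = 1 := by
  revert a
  decide

/-- Flipping a coordinate in the support lowers the Hamming weight. -/
theorem hammingNorm_add_single_lt {n : ℕ} {y : Fin n → ZMod 2} {i : Fin n} (hi : y i ≠ 0) :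
    hammingNorm (y + Pi.single i 1) < hammingNorm y := by
  unfold hammingNorm
  refine Finset.card_lt_card ((Finset.ssubset_iff_of_subset fun j hj => ?_).2 ⟨i, ?_, ?_⟩)
  · by_cases h : j = i
    · simpa [h] using hi
    · simpa [Pi.single_apply, h] using hj
  · simpa using hi
  · simp [ZMod.eq_one_of_ne_zero_two hi, CharTwo.add_self_eq_zero]

/-- Every coset contains a coset leader. -/
theorem exists_isCosetLeader {n : ℕ} (C : Submodule (ZMod 2) (Fin n → ZMod 2))
    (y : Fin n → ZMod 2) :
    ∃ v, y - v ∈ C ∧ IsCosetLeader C v := by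
  obtain ⟨v, hv, hmin⟩ := Set.exists_min_image {v | y - v ∈ C} hammingNorm (Set.toFinite _)
    ⟨y, by simp⟩
  refine ⟨v, hv, fun u hu => hmin u ?_⟩
  simpa using C.add_mem hv hu

theorem stmt_8 {n : ℕ} (C : Submodule (ZMod 2) (Fin n → ZMod 2))
    (y : Fin n → ZMod 2) (hy : ¬ IsCosetLeader C y) :
    ∃ t ∈ leaderCodewords C, hammingNorm (y + t) < hammingNorm y := by
  induction hw : hammingNorm y using Nat.strong_induction_on generalizing y with
  | _ w ih =>
    subst hw
    have hy0 : y ≠ 0 := by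
      rintro rfl
      exact hy fun v _ => by simp
    obtain ⟨i, hi⟩ := Function.ne_iff.1 hy0
    have hlt := hammingNorm_add_single_lt hi
    have hflip : y + Pi.single i 1 + Pi.single i 1 = y := by
      rw [add_assoc, ZModModule.add_self, add_zero]
    by_cases hl : IsCosetLeader C (y + Pi.single i 1)
    · obtain ⟨v, hv, hvl⟩ := exists_isCosetLeader C y
      have hvy : hammingNorm v < hammingNorm y := by
        by_contra! h
        refine hy fun u hu => h.trans (hvl u ?_)
        simpa using C.sub_mem hu hv
      rw [ZModModule.sub_eq_add] at hv
      refine ⟨y + v, ⟨hv, fun h => ?_, y + Pi.single i 1, v, i, hl, hvl, ?_, ?_⟩, ?_⟩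
      · rw [← ZModModule.sub_eq_add, sub_eq_zero] at h
        exact hvy.ne (by rw [h])
      · simp [ZMod.eq_one_of_ne_zero_two hi, CharTwo.add_self_eq_zero]
      · rw [add_right_comm, hflip]
      · rwa [← add_assoc, ZModModule.add_self, zero_add]
    · obtain ⟨t, ht, htl⟩ := ih _ hlt _ hl rfl
      refine ⟨t, ht, ?_⟩
      have h := hammingNorm_add_le_add (y + Pi.single i 1 + t) (Pi.single i 1)
      rw [add_right_comm, hflip] at h
      have := hammingNorm_pi_single_one_le i
      omega
end

section
/- Let C be a binary linear code of length n with covering radius ρ(C). Then every leader codeword c in L(C) satisfies w_H(c) ≤ 2ρ(C) + 1. -/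
/-- The covering radius of `C`. -/
noncomputable def coveringRadius {n : ℕ} (C : Submodule (ZMod 2) (Fin n → ZMod 2)) : ℕ :=
  sSup {r : ℕ | ∃ y : Fin n → ZMod 2,
    r = sInf {d : ℕ | ∃ c ∈ C, hammingDist y c = d}}

theorem hammingNorm_add_le {ι : Type*} {β : ι → Type*} [Fintype ι] [∀ i, DecidableEq (β i)]
    [∀ i, AddGroup (β i)] (x y : ∀ i, β i) :
    hammingNorm (x + y) ≤ hammingNorm x + hammingNorm y := by
  have h := hammingDist_triangle (x + y) x 0
  rw [hammingDist_comm (x + y) x, hammingDist_eq_hammingNorm x, neg_add_cancel_left,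
    hammingDist_zero_right, hammingDist_zero_right] at h
  exact h.trans_eq (add_comm _ _)

theorem hammingNorm_single_le {ι : Type*} {β : ι → Type*} [Fintype ι] [DecidableEq ι]
    [∀ i, DecidableEq (β i)] [∀ i, Zero (β i)] (i : ι) (a : β i) :
    hammingNorm (Pi.single i a) ≤ 1 := by
  refine (Finset.card_le_card (t := {i}) fun j hj => ?_).trans (Finset.card_singleton i).le
  by_contra hji
  simp_all [Pi.single_eq_of_ne]

theorem IsCosetLeader.hammingNorm_le_coveringRadius {n : ℕ}
    {C : Submodule (ZMod 2) (Fin n → ZMod 2)} {w : Fin n → ZMod 2} (hw : IsCosetLeader C w) :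
    hammingNorm w ≤ coveringRadius C := by
  have hfin : {r : ℕ | ∃ y : Fin n → ZMod 2,
      r = sInf {d : ℕ | ∃ c ∈ C, hammingDist y c = d}}.Finite :=
    (Set.finite_range fun y : Fin n → ZMod 2 =>
      sInf {d : ℕ | ∃ c ∈ C, hammingDist y c = d}).subset
      fun r ⟨y, hy⟩ => ⟨y, hy.symm⟩
  refine le_trans ?_ (le_csSup hfin.bddAbove ⟨w, rfl⟩)
  refine le_csInf ⟨_, 0, C.zero_mem, rfl⟩ ?_
  rintro _ ⟨c, hc, rfl⟩
  rw [hammingDist_comm, hammingDist_eq_hammingNorm]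
  exact hw _ (by simpa using hc)

theorem stmt_9 {n : ℕ} (C : Submodule (ZMod 2) (Fin n → ZMod 2))
    (c : Fin n → ZMod 2) (hc : c ∈ leaderCodewords C) :
    hammingNorm c ≤ 2 * coveringRadius C + 1 := by
  obtain ⟨-, -, n1, n2, i, h1, h2, -, rfl⟩ := hc
  have h3 := hammingNorm_add_le (n1 + n2) (Pi.single i 1)
  have h4 := hammingNorm_add_le n1 n2
  have h5 := hammingNorm_single_le (β := fun _ : Fin n => ZMod 2) i 1
  have h6 := h1.hammingNorm_le_coveringRadius
  have h7 := h2.hammingNorm_le_coveringRadius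
  omega
end

section
/- Let C be a binary linear code of length n such that every coset of C has a unique coset leader (in particular this holds when C is a perfect code), and let ≺ be a total order on F_2^n compatible with Hamming weight. Then L(C) = L^1(C), where L(C) is taken in its weight-restricted form L(C) = {n1 + n2 + e_i in C \ {0} : i not in supp(n1), n1, n2 in CL(C), and w_H(n1 + e_i) > w_H(n2)}; in particular |L(C)| = |L^1(C)|. -/
/-- The minimum of a coset for a weight-compatible strict total order is a coset leader. -/
theorem isCosetLeader_of_minimal {n : ℕ} (C : Submodule (ZMod 2) (Fin n → ZMod 2))
    (lt : (Fin n → ZMod 2) → (Fin n → ZMod 2) → Prop)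
    (hord : IsStrictTotalOrder (Fin n → ZMod 2) lt)
    (hcompat : ∀ a b : Fin n → ZMod 2, hammingNorm a < hammingNorm b → lt a b)
    {y w : Fin n → ZMod 2} (hmem : y - w ∈ C)
    (hmin : ∀ v : Fin n → ZMod 2, y - v ∈ C → v = w ∨ lt w v) :
    IsCosetLeader C w := by
  intro v hv
  by_contra! hlt
  have hyv : y - v ∈ C := by simpa using C.add_mem hmem hv
  rcases hmin v hyv with rfl | hwv
  · exact lt_irrefl _ hlt
  · exact irrefl_of lt w (trans_of lt hwv (hcompat v w hlt))


theorem stmt_12 {n : ℕ} (C : Submodule (ZMod 2) (Fin n → ZMod 2))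
    -- every coset of `C` has a unique coset leader
    (huniq : ∀ z1 z2 : Fin n → ZMod 2, IsCosetLeader C z1 → IsCosetLeader C z2 →
      z1 - z2 ∈ C → z1 = z2)
    -- a total (strict) order on words compatible with the Hamming weight
    (lt : (Fin n → ZMod 2) → (Fin n → ZMod 2) → Prop)
    (hord : IsStrictTotalOrder (Fin n → ZMod 2) lt)
    (hcompat : ∀ a b : Fin n → ZMod 2, hammingNorm a < hammingNorm b → lt a b)
    -- `Nf y` is the `lt`-minimum element of the coset `C + y`
    (Nf : (Fin n → ZMod 2) → (Fin n → ZMod 2))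
    (hNmem : ∀ y : Fin n → ZMod 2, y - Nf y ∈ C)
    (hNmin : ∀ y v : Fin n → ZMod 2, y - v ∈ C → v = Nf y ∨ lt (Nf y) v) :
    -- `L(C)` (in its weight-restricted form) equals `L¹(C)`
    {c : Fin n → ZMod 2 | c ∈ C ∧ c ≠ 0 ∧
        ∃ (n1 n2 : Fin n → ZMod 2) (i : Fin n),
          IsCosetLeader C n1 ∧ IsCosetLeader C n2 ∧ n1 i = 0 ∧
          hammingNorm n2 < hammingNorm (n1 + Pi.single i 1) ∧
          c = n1 + n2 + Pi.single i 1}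
      = {c : Fin n → ZMod 2 | c ∈ C ∧ c ≠ 0 ∧
        ∃ (n1 n2 : Fin n → ZMod 2) (i : Fin n),
          IsCosetLeader C n1 ∧ n2 ∈ Set.range Nf ∧ n1 i = 0 ∧
          hammingNorm n2 < hammingNorm (n1 + Pi.single i 1) ∧
          c = n1 + n2 + Pi.single i 1} := by
  have hlead (w : Fin n → ZMod 2) : IsCosetLeader C w ↔ w ∈ Set.range Nf := by
    refine ⟨fun hw => ⟨w, ?_⟩, ?_⟩
    · exact (huniq w (Nf w) hw
        (isCosetLeader_of_minimal C lt hord hcompat (hNmem w) (hNmin w)) (hNmem w)).symm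
    · rintro ⟨y, rfl⟩
      exact isCosetLeader_of_minimal C lt hord hcompat (hNmem y) (hNmin y)
  simp only [hlead]
end

section
/- Let C be a binary linear code of length n and let z be a nonzero codeword of C with X(D(0)) ∩ D(z) ≠ ∅. Then z is a zero neighbour of C, i.e. δ(D(z)) ∩ δ(D(0)) ≠ ∅. -/
/-- The Voronoi region of a codeword `c` of `C`. -/
def voronoi {n : ℕ} (C : Submodule (ZMod 2) (Fin n → ZMod 2))
    (c : Fin n → ZMod 2) : Set (Fin n → ZMod 2) :=
  {y | ∀ c' ∈ C, hammingDist y c ≤ hammingDist y c'}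

/-- `X(A)`: the set of words at Hamming distance exactly 1 from `A`. -/
noncomputable def distOneSet {n : ℕ} (A : Set (Fin n → ZMod 2)) :
    Set (Fin n → ZMod 2) :=
  {y | sInf {d : ℕ | ∃ a ∈ A, hammingDist y a = d} = 1}

/-- The boundary of a set `A`: `δ(A) = X(A) ∪ X(F₂ⁿ \ A)`. -/
noncomputable def boundarySet {n : ℕ} (A : Set (Fin n → ZMod 2)) :
    Set (Fin n → ZMod 2) :=
  distOneSet A ∪ distOneSet Aᶜ

theorem mem_distOneSet_iff {n : ℕ} {A : Set (Fin n → ZMod 2)} {y : Fin n → ZMod 2} :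
    y ∈ distOneSet A ↔ y ∉ A ∧ ∃ a ∈ A, hammingDist y a = 1 := by
  constructor
  · intro h
    change sInf {d : ℕ | ∃ a ∈ A, hammingDist y a = d} = 1 at h
    refine ⟨fun hy => ?_, ?_⟩
    · have := Nat.sInf_le (s := {d : ℕ | ∃ a ∈ A, hammingDist y a = d})
        ⟨y, hy, hammingDist_self y⟩
      omega
    · have := Nat.sInf_mem (Nat.nonempty_of_pos_sInf (h ▸ Nat.one_pos))
      rwa [h] at this
  · rintro ⟨hy, a, ha, hd⟩
    refine le_antisymm (Nat.sInf_le ⟨a, ha, hd⟩)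
      (le_csInf ⟨1, a, ha, hd⟩ ?_)
    rintro d ⟨b, hb, rfl⟩
    exact hammingDist_pos.mpr (fun h => hy (h ▸ hb))

theorem hammingDist_update_self {n : ℕ} {x : Fin n → ZMod 2} {j : Fin n} {a : ZMod 2}
    (ha : x j ≠ a) : hammingDist x (Function.update x j a) = 1 := by
  rw [hammingDist, Finset.card_eq_one]
  refine ⟨j, ?_⟩
  ext i
  by_cases h : i = j
  · subst h
    simpa using ha
  · simp [h]

/-- A word at least as close to a nonzero word `z` as to `0` meets the support of `z`. -/
theorem exists_ne_zero_of_hammingDist_le {n : ℕ} {x z : Fin n → ZMod 2} (hz : z ≠ 0)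
    (h : hammingDist x z ≤ hammingDist x 0) : ∃ j, x j ≠ 0 ∧ z j ≠ 0 := by
  by_contra! hdisj
  obtain ⟨k, hk⟩ := Function.ne_iff.mp hz
  refine h.not_gt (Finset.card_lt_card (Finset.ssubset_iff_of_subset ?_ |>.mpr ⟨k, ?_, ?_⟩))
  · intro i hi
    simp only [Finset.mem_filter, Finset.mem_univ, true_and, Pi.zero_apply] at hi ⊢
    rwa [hdisj i hi]
  all_goals
    have hxk : x k = 0 := by
      by_contra hx
      exact hk (hdisj k hx)
    simp [hxk]
  exact Ne.symm hk

/-- A word of `D(0) ∩ D(z)` is adjacent to a word outside `D(z)`. -/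
theorem mem_distOneSet_compl_voronoi {n : ℕ} {C : Submodule (ZMod 2) (Fin n → ZMod 2)}
    {x z : Fin n → ZMod 2} (hzC : z ∈ C) (hz : z ≠ 0)
    (hx0 : x ∈ voronoi C 0) (hxz : x ∈ voronoi C z) :
    x ∈ distOneSet (voronoi C z)ᶜ := by
  obtain ⟨j, hxj, hzj⟩ := exists_ne_zero_of_hammingDist_le hz (hxz 0 C.zero_mem)
  have hxzj : x j = z j :=
    (Fin.eq_one_of_ne_zero (x j) hxj).trans (Fin.eq_one_of_ne_zero (z j) hzj).symm
  refine mem_distOneSet_iff.mpr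
    ⟨not_not_intro hxz, Function.update x j 0, fun hu => ?_, hammingDist_update_self hxj⟩
  have hlt : hammingDist (Function.update x j 0) 0 < hammingDist x 0 := by
    refine Finset.card_lt_card (Finset.ssubset_iff_of_subset ?_ |>.mpr ⟨j, ?_, ?_⟩)
    · intro i
      by_cases h : i = j <;> simp [h]
    · simpa using hxj
    · simp
  have hle : hammingDist x z ≤ hammingDist (Function.update x j 0) z := by
    refine Finset.card_le_card fun i => ?_
    by_cases h : i = j
    · subst h
      simp [hxzj]
    · simp [h]
  exact (hlt.trans_le ((hx0 z hzC).trans hle)).not_ge (hu 0 C.zero_mem)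

theorem stmt_15 {n : ℕ} (C : Submodule (ZMod 2) (Fin n → ZMod 2))
    (z : Fin n → ZMod 2) (hzC : z ∈ C) (hz0 : z ≠ 0)
    (h : (distOneSet (voronoi C 0) ∩ voronoi C z).Nonempty) :
    (boundarySet (voronoi C z) ∩ boundarySet (voronoi C 0)).Nonempty := by
  obtain ⟨y, hy, hyz⟩ := h
  obtain ⟨hy0, x, hx0, hyx⟩ := mem_distOneSet_iff.mp hy
  by_cases hxz : x ∈ voronoi C z
  · exact ⟨x, Or.inr (mem_distOneSet_compl_voronoi hzC hz0 hx0 hxz),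
      Or.inr (mem_distOneSet_iff.mpr
        ⟨not_not_intro hx0, y, hy0, (hammingDist_comm x y).trans hyx⟩)⟩
  · exact ⟨y, Or.inr (mem_distOneSet_iff.mpr ⟨not_not_intro hyz, x, hxz, hyx⟩), Or.inl hy⟩
end

section
/- Let C be a binary linear code of length n and let y in F_2^n be a word that is not a coset leader of C. Then there exist a coset leader n1 of C and a coordinate i such that supp(n1) ⊆ supp(y), i ∈ supp(y), i ∉ supp(n1), and n1 + e_i is not a coset leader of C. -/
theorem isCosetLeader_zero {n : ℕ} (C : Submodule (ZMod 2) (Fin n → ZMod 2)) :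
    IsCosetLeader C 0 := by
  intro v _
  simp

theorem stmt_16 {n : ℕ} (C : Submodule (ZMod 2) (Fin n → ZMod 2))
    (y : Fin n → ZMod 2) (hy : ¬ IsCosetLeader C y) :
    ∃ (n1 : Fin n → ZMod 2) (i : Fin n),
      IsCosetLeader C n1 ∧
      (∀ j : Fin n, n1 j ≠ 0 → y j ≠ 0) ∧
      y i ≠ 0 ∧ n1 i = 0 ∧
      ¬ IsCosetLeader C (n1 + Pi.single i 1) := by
  have binary : ∀ a : ZMod 2, a ≠ 0 → a = 1 := by decide
  obtain ⟨S, hS⟩ : ∃ S : Finset (Fin n), ∀ j, y j ≠ 0 → j ∈ S :=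
    ⟨Finset.univ, fun j _ => Finset.mem_univ j⟩
  induction S using Finset.induction_on generalizing y with
  | empty =>
    have h0 : y = 0 := funext fun j => by simpa using hS j
    exact absurd (h0 ▸ isCosetLeader_zero C) hy
  | insert i S _ ih =>
    have hsupp : ∀ j, Function.update y i 0 j ≠ 0 → j ≠ i ∧ y j ≠ 0 := by
      intro j hj
      rcases eq_or_ne j i with rfl | hji
      · simp at hj
      · exact ⟨hji, by simpa [hji] using hj⟩
    by_cases hlead : IsCosetLeader C (Function.update y i 0)
    · have hi : y i ≠ 0 := fun h => hy (by rwa [← h, Function.update_eq_self] at hlead)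
      refine ⟨Function.update y i 0, i, hlead, fun j hj => (hsupp j hj).2, hi, by simp, ?_⟩
      convert hy using 2
      ext j
      rcases eq_or_ne j i with rfl | hji
      · simp [binary _ hi]
      · simp [hji]
    · obtain ⟨n1, k, h1, h2, h3, h4⟩ := ih (Function.update y i 0) hlead fun j hj =>
        Finset.mem_of_mem_insert_of_ne (hS j (hsupp j hj).2) (hsupp j hj).1
      exact ⟨n1, k, h1, fun j hj => (hsupp j (h2 j hj)).2, (hsupp k h3).2, h4⟩
end
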